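/- (Duality formula, Laguerre case.) Let N ≥ 1, m ≥ 1, q = (q_1,…,q_m) with each q_i ∈ ℕ, q_i ≥ 1, |q| := q_1+⋯+q_m, τ(i) := Σ_{l=1}^{i−1} 2q_l, α > −1 real, and let μ_1,…,μ_m ∈ ℝ be pairwise distinct. With the Laguerre weight ω_N(x) = x^α e^{−4Nx} on Ω = (0,∞) one has H_{N,N,m,q}(μ)/H_{N+|q|,N} = h_{N,m,q} · ∏_{i=1}^m (∏_{l=1}^{2q_i} l!)^{−1} · ∏_{1≤j<k≤m}(μ_k − μ_j)^{−4 q_j q_k} · I_{N,m,q}(μ), where h_{N,m,q} := ∏_{j=1}^{2|q|} [ (−1)^{N+j−1} (N+j−1)! · N^{−(N+j−1)} · 2^{−(2N+j+α)} / (π i) ] · ∏_{i=1}^m ∏_{l=1}^{2q_i} (−2N)^{l−1} · H_{N,N}/H_{N+|q|,N}, and I_{N,m,q}(μ) is the 2|q|-fold iterated contour integral, each variable z_l running over the positively oriented unit circle |z| = 1 in ℂ, of ∏_{i=1}^m ∏_{l=τ(i)+1}^{τ(i+1)} [ e^{−2Nμ_i z_l} (z_l+2)^N z_l^{−N} ·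 i (z_l+2)^α z_l^{−2q_i} ] · ∏_{i=1}^m Δ_{2q_i}(z_{τ(i)+1},…,z_{τ(i+1)})² · ∏_{1≤j<k≤m} ∏_{l_k=τ(k)+1}^{τ(k+1)} ∏_{l_j=τ(j)+1}^{τ(j+1)} (z_{l_k}^{−1} − z_{l_j}^{−1}), where (z+2)^α denotes the principal complex power (well-defined since Re(z+2) > 0 on |z| = 1) and i is the imaginary unit. -/

import Mathlib

open MeasureTheory Finset

/-- The Vandermonde product for a real tuple. -/
noncomputable def vandR {n : ℕ} (z : Fin n → ℝ) : ℝ :=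
  ∏ j : Fin n, ∏ k ∈ Finset.Ioi j, (z k - z j)

/-- The Vandermonde product for a complex tuple. -/
noncomputable def vandC {n : ℕ} (z : Fin n → ℂ) : ℂ :=
  ∏ j : Fin n, ∏ k ∈ Finset.Ioi j, (z k - z j)

open Polynomial in
theorem det_functional_monic {R ι : Type*} [CommRing R] [Fintype ι] [DecidableEq ι]
    {n : ℕ} (e : ι ≃ Fin n) (φ : ι → R[X] →ₗ[R] R) (p : ι → R[X])
    (hp : ∀ c, (p c).Monic) (hd : ∀ c, (p c).natDegree = e c) :
    (Matrix.of fun r c => φ r (p c)).det =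
      (Matrix.of fun r c => φ r (X ^ (e c : ℕ))).det := by
  have h : (Matrix.of fun r c => φ r (p c)) =
      (Matrix.of fun r c => φ r (X ^ (e c : ℕ))) *
        (Matrix.of fun j c : Fin n => (p (e.symm c)).coeff j).submatrix e e := by
    ext r c
    simp only [Matrix.of_apply, Matrix.mul_apply, Matrix.submatrix_apply, Equiv.symm_apply_apply]
    rw [e.sum_comp (fun j : Fin n => φ r (X ^ (j : ℕ)) * (p c).coeff j),
      Fin.sum_univ_eq_sum_range (fun j => φ r (X ^ j) * (p c).coeff j)]
    conv_lhs => rw [(p c).as_sum_range' n (by rw [hd]; exact (e c).2)]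
    rw [map_sum]
    refine Finset.sum_congr rfl fun j _ => ?_
    rw [← C_mul_X_pow_eq_monomial, ← smul_eq_C_mul, map_smul, smul_eq_mul, mul_comm]
  rw [h, Matrix.det_mul, Matrix.det_submatrix_equiv_self,
    Matrix.det_matrixOfPolynomials _ (fun i => by rw [hd, Equiv.apply_symm_apply])
      (fun i => hp _), mul_one]

open Polynomial in
theorem det_functional_monic_congr {R ι : Type*} [CommRing R] [Fintype ι] [DecidableEq ι]
    {n : ℕ} (e : ι ≃ Fin n) (φ : ι → R[X] →ₗ[R] R) (p p' : ι → R[X])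
    (hp : ∀ c, (p c).Monic) (hd : ∀ c, (p c).natDegree = e c)
    (hp' : ∀ c, (p' c).Monic) (hd' : ∀ c, (p' c).natDegree = e c) :
    (Matrix.of fun r c => φ r (p c)).det = (Matrix.of fun r c => φ r (p' c)).det := by
  rw [det_functional_monic e φ p hp hd, det_functional_monic e φ p' hp' hd']

open Polynomial in
/-- Newton basis polynomial attached to a family of nodes with lexicographically ordered
sigma-type indices. -/
noncomputable def newtonSigma {R : Type*} [CommRing R] {m : ℕ} {n : Fin m → ℕ}
    (y : (Σ i, Fin (n i)) → R) (s : Σ i, Fin (n i)) : R[X] :=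
  (∏ j ∈ Finset.Iio s.1, ∏ l : Fin (n j), (X - C (y ⟨j, l⟩))) *
    ∏ l ∈ Finset.Iio s.2, (X - C (y ⟨s.1, l⟩))

open Polynomial in
theorem newtonSigma_monic {R : Type*} [CommRing R] {m : ℕ} {n : Fin m → ℕ}
    (y : (Σ i, Fin (n i)) → R) (s : Σ i, Fin (n i)) : (newtonSigma y s).Monic :=
  (monic_prod_of_monic _ _ fun _ _ => monic_prod_of_monic _ _ fun _ _ => monic_X_sub_C _).mul
    (monic_prod_of_monic _ _ fun _ _ => monic_X_sub_C _)

open Polynomial in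
theorem newtonSigma_natDegree {R : Type*} [CommRing R] [Nontrivial R] {m : ℕ} {n : Fin m → ℕ}
    (y : (Σ i, Fin (n i)) → R) (s : Σ i, Fin (n i)) :
    (newtonSigma y s).natDegree = finSigmaFinEquiv s := by
  rw [newtonSigma, (monic_prod_of_monic _ _ fun _ _ => monic_prod_of_monic _ _ fun _ _ =>
    monic_X_sub_C _).natDegree_mul (monic_prod_of_monic _ _ fun _ _ => monic_X_sub_C _),
    natDegree_prod_of_monic _ _ fun _ _ => monic_prod_of_monic _ _ fun _ _ => monic_X_sub_C _,
    natDegree_prod_of_monic _ _ fun _ _ => monic_X_sub_C _]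
  rw [finSigmaFinEquiv_apply]
  congr 1
  · have : ∀ j : Fin m, (∏ l : Fin (n j), (X - C (y ⟨j, l⟩))).natDegree = n j := fun j => by
      rw [natDegree_prod_of_monic _ _ fun _ _ => monic_X_sub_C _]; simp
    simp only [this]
    symm
    refine Finset.sum_bij (fun a _ => Fin.castLE s.1.2.le a) ?_ ?_ ?_ ?_
    · intro a _; rw [Finset.mem_Iio, Fin.lt_def]; exact a.2
    · intro a _ b _ h; exact Fin.castLE_injective _ h
    · intro b hb; exact ⟨⟨b, by simpa only [Finset.mem_Iio, Fin.lt_def] using hb⟩, Finset.mem_univ _, rfl⟩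
    · intro a _; rfl
  · simp

theorem det_of_sigma_lowerTriangular {R : Type*} [CommRing R] {m : ℕ} {n : Fin m → ℕ}
    (M : Matrix (Σ i, Fin (n i)) (Σ i, Fin (n i)) R)
    (h₁ : ∀ s t, s.1 < t.1 → M s t = 0)
    (h₂ : ∀ i, ∀ l l' : Fin (n i), l < l' → M ⟨i, l⟩ ⟨i, l'⟩ = 0) :
    M.det = ∏ s, M s s := by
  have key := Matrix.det_of_isLowerTriangular
    (M.submatrix (ofLex : (Σₗ i, Fin (n i)) ≃ Σ i, Fin (n i)) ofLex) ?_
  · rw [Matrix.det_submatrix_equiv_self] at key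
    rw [key]
    exact Equiv.prod_comp (ofLex : (Σₗ i, Fin (n i)) ≃ Σ i, Fin (n i)) (fun s => M s s)
  · rintro ⟨i, l⟩ ⟨j, k⟩ h
    rcases Sigma.Lex.lt_def.1 (OrderDual.toDual_lt_toDual.1 h) with h | ⟨h, h'⟩
    · exact h₁ _ _ h
    · dsimp only at h
      subst h
      exact h₂ _ _ _ h'

open Polynomial in
/-- The determinant of functionals that are triangular with respect to a Newton basis. -/
theorem det_functional_eq_prod_newton {R : Type*} [CommRing R] [Nontrivial R] {m : ℕ}
    {n : Fin m → ℕ}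
    (y : (Σ i, Fin (n i)) → R) (φ : (Σ i, Fin (n i)) → R[X] →ₗ[R] R)
    (h₁ : ∀ s t, s.1 < t.1 → φ s (newtonSigma y t) = 0)
    (h₂ : ∀ i, ∀ l l' : Fin (n i), l < l' → φ ⟨i, l⟩ (newtonSigma y ⟨i, l'⟩) = 0) :
    (Matrix.of fun r c => φ r (X ^ (finSigmaFinEquiv c : ℕ))).det =
      ∏ s, φ s (newtonSigma y s) := by
  rw [← det_functional_monic finSigmaFinEquiv φ (newtonSigma y) (newtonSigma_monic y)
    (newtonSigma_natDegree y)]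
  exact det_of_sigma_lowerTriangular _ h₁ h₂

/-- Vandermonde determinant over a sigma type, split into blocks. -/
theorem det_vandermonde_sigma {R : Type*} [CommRing R] [Nontrivial R] {m : ℕ}
    {n : Fin m → ℕ} (y : (Σ i, Fin (n i)) → R) :
    (Matrix.of fun r c : Σ i, Fin (n i) => y r ^ (finSigmaFinEquiv c : ℕ)).det =
      (∏ i, (Matrix.vandermonde fun l => y ⟨i, l⟩).det) *
      ∏ j : Fin m, ∏ k ∈ Finset.Ioi j, ∏ lk : Fin (n k), ∏ lj : Fin (n j),
        (y ⟨k, lk⟩ - y ⟨j, lj⟩) := by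
  have := det_functional_eq_prod_newton y (fun s => Polynomial.leval (y s)) ?_ ?_
  · simp only [Polynomial.leval_apply, Polynomial.eval_pow, Polynomial.eval_X] at this
    rw [this]
    simp only [newtonSigma, Polynomial.eval_mul, Polynomial.eval_prod, Polynomial.eval_sub,
      Polynomial.eval_X, Polynomial.eval_C]
    rw [Finset.prod_mul_distrib, mul_comm]
    congr 1
    · rw [Fintype.prod_sigma]
      refine Finset.prod_congr rfl fun i _ => ?_
      rw [Matrix.det_vandermonde]
      dsimp only
      exact Finset.prod_comm' fun a b => by simp
    · rw [Fintype.prod_sigma]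
      rw [Finset.prod_comm' (t' := Finset.univ) (s' := fun j => Finset.Iio j)
        (s := Finset.univ) (t := fun j => Finset.Ioi j) (fun x y => by simp)]
      refine Finset.prod_congr rfl fun i _ => ?_
      dsimp only
      rw [Finset.prod_comm]
  · intro s t h
    simp only [Polynomial.leval_apply, newtonSigma, Polynomial.eval_mul, Polynomial.eval_prod]
    rw [Finset.prod_eq_zero (i := s.1) (by simpa using h)
      (Finset.prod_eq_zero (Finset.mem_univ s.2) (by simp)), zero_mul]
  · intro i l l' h
    simp only [Polynomial.leval_apply, newtonSigma, Polynomial.eval_mul, Polynomial.eval_prod]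
    rw [mul_comm, Finset.prod_eq_zero (i := l) (by simpa using h) (by simp), zero_mul]

open Polynomial in
/-- Evaluation at a point of the `l`-th derivative of a multiple of `Q`. -/
noncomputable def derivFunctional {R : Type*} [CommRing R] (Q : R[X]) (x : R) (l : ℕ) :
    R[X] →ₗ[R] R :=
  leval x ∘ₗ (derivative ^ l) ∘ₗ LinearMap.mulLeft R Q

open Polynomial in
theorem derivFunctional_apply {R : Type*} [CommRing R] (Q : R[X]) (x : R) (l : ℕ) (p : R[X]) :
    derivFunctional Q x l p = (derivative^[l] (Q * p)).eval x := by
  simp [derivFunctional, Module.End.pow_apply]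

open Polynomial in
theorem eval_iterate_derivative_X_sub_C_pow_mul {R : Type*} [CommRing R] (x : R) (l : ℕ)
    (p : R[X]) : (derivative^[l] ((X - C x) ^ l * p)).eval x = l.factorial * p.eval x := by
  rw [iterate_derivative_mul, eval_finsetSum, Finset.sum_eq_single 0]
  · simp [iterate_derivative_X_sub_pow_self]
  · intro k hk hk0
    have : k ≤ l := by simpa [Nat.lt_succ_iff] using hk
    simp [iterate_derivative_X_sub_pow, show l - (l - k) = k by omega, hk0]
  · simp

open Polynomial in
theorem eval_iterate_derivative_eq_zero {R : Type*} [CommRing R] (x : R) {l k : ℕ} (h : l < k)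
    (p : R[X]) : (derivative^[l] ((X - C x) ^ k * p)).eval x = 0 := by
  obtain ⟨d, rfl⟩ := Nat.exists_eq_add_of_lt h
  rw [show l + d + 1 = l + (d + 1) from rfl, pow_add, mul_assoc,
    eval_iterate_derivative_X_sub_C_pow_mul]
  simp

open Polynomial in
/-- Confluent Vandermonde determinant, twisted by a polynomial `Q`. -/
theorem det_confluent {R : Type*} [CommRing R] [Nontrivial R] {m : ℕ}
    {n : Fin m → ℕ} (x : Fin m → R) (Q : R[X]) :
    (Matrix.of fun r c : Σ i, Fin (n i) =>
      derivFunctional Q (x r.1) r.2 (X ^ (finSigmaFinEquiv c : ℕ))).det =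
      (∏ i, ∏ l : Fin (n i), ((l : ℕ).factorial : R)) * (∏ i, Q.eval (x i) ^ n i) *
      ∏ j : Fin m, ∏ k ∈ Finset.Ioi j, (x k - x j) ^ (n j * n k) := by
  have hN : ∀ s : Σ i, Fin (n i), newtonSigma (fun s => x s.1) s =
      (X - C (x s.1)) ^ (s.2 : ℕ) * ∏ j ∈ Finset.Iio s.1, (X - C (x j)) ^ n j := by
    intro s; simp [newtonSigma, mul_comm]
  rw [det_functional_eq_prod_newton (fun s => x s.1)]
  · simp only [derivFunctional_apply, hN]
    simp_rw [mul_left_comm Q, eval_iterate_derivative_X_sub_C_pow_mul]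
    rw [Fintype.prod_sigma]
    simp only [Finset.prod_mul_distrib, eval_mul, eval_prod, eval_pow, eval_sub, eval_X, eval_C]
    rw [mul_assoc]
    congr 2
    · simp
    · rw [Finset.prod_comm' (t' := Finset.univ) (s' := fun j => Finset.Iio j)
        (s := Finset.univ) (t := fun j => Finset.Ioi j) (by simp)]
      simp [← Finset.prod_pow, pow_mul]
  · intro s t h
    simp only [derivFunctional_apply, hN]
    rw [← Finset.mul_prod_erase _ _ (show s.1 ∈ Finset.Iio t.1 by simpa using h),
      mul_left_comm _ ((X - C (x s.1)) ^ n s.1), mul_left_comm Q,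
      eval_iterate_derivative_eq_zero _ s.2.2]
  · intro i l l' h
    simp only [derivFunctional_apply, hN]
    rw [mul_left_comm, eval_iterate_derivative_eq_zero _ h]

/-- Integrating a determinant whose upper rows depend on separate variables. -/
theorem integral_det_rows {𝕜 ι κ E : Type*} [RCLike 𝕜] [Fintype ι] [DecidableEq ι] [Fintype κ]
    [DecidableEq κ] [MeasurableSpace E] (ν : Measure E) [SigmaFinite ν]
    (g : ι → ι ⊕ κ → E → 𝕜) (B : κ → ι ⊕ κ → 𝕜) (hg : ∀ l c, Integrable (g l c) ν) :
    Integrable (fun z : ι → E => (Matrix.of (Sum.elim (fun l c => g l c (z l)) B)).det)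
        (Measure.pi fun _ => ν) ∧
    ∫ z : ι → E, (Matrix.of (Sum.elim (fun l c => g l c (z l)) B)).det ∂(Measure.pi fun _ => ν) =
      (Matrix.of (Sum.elim (fun l c => ∫ x, g l c x ∂ν) B)).det := by
  have h_integrable : ∀ τ : Equiv.Perm (ι ⊕ κ), Integrable (fun z : ι → E =>
      ((Equiv.Perm.sign τ : ℤ) : 𝕜) * ((∏ l, g l (τ (Sum.inl l)) (z l)) *
        ∏ s, B s (τ (Sum.inr s)))) (Measure.pi fun _ => ν) := fun τ =>
    ((Integrable.fintype_prod (μ := fun _ : ι => ν)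
      (fun l => hg l (τ (Sum.inl l)))).mul_const _).const_mul _
  simp_rw [← Matrix.det_transpose (Matrix.of (Sum.elim _ B)), Matrix.det_apply', Fintype.prod_sum_type,
    Matrix.transpose_apply, Matrix.of_apply, Sum.elim_inl, Sum.elim_inr]
  refine ⟨integrable_finsetSum _ fun τ _ => h_integrable τ, ?_⟩
  rw [integral_finsetSum _ fun τ _ => h_integrable τ]
  refine Finset.sum_congr rfl fun τ _ => ?_
  rw [integral_const_mul, integral_mul_const,
    integral_fintype_prod_eq_prod (fun l x => g l (τ (Sum.inl l)) x)]

theorem integral_det {𝕜 ι E : Type*} [RCLike 𝕜] [Fintype ι] [DecidableEq ι]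
    [MeasurableSpace E] (ν : Measure E) [SigmaFinite ν]
    (g : ι → ι → E → 𝕜) (hg : ∀ l c, Integrable (g l c) ν) :
    ∫ z : ι → E, (Matrix.of (fun l c => g l c (z l))).det ∂(Measure.pi fun _ => ν) =
      (Matrix.of (fun l c => ∫ x, g l c x ∂ν)).det := by
  have h_integrable : ∀ τ : Equiv.Perm ι, Integrable (fun z : ι → E =>
      ((Equiv.Perm.sign τ : ℤ) : 𝕜) * (∏ l, g l (τ l) (z l))) (Measure.pi fun _ => ν) := fun τ =>
    (Integrable.fintype_prod (μ := fun _ : ι => ν) (fun l => hg l (τ l))).const_mul _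
  simp_rw [← Matrix.det_transpose (Matrix.of _), Matrix.det_apply',
    Matrix.transpose_apply, Matrix.of_apply]
  rw [integral_finsetSum _ fun τ _ => h_integrable τ]
  refine Finset.sum_congr rfl fun τ _ => ?_
  rw [integral_const_mul, integral_fintype_prod_eq_prod (fun l x => g l (τ l) x)]

/-- An Andréief-type identity with extra constant rows. -/
theorem integral_det_mul_det {𝕜 ι κ E : Type*} [RCLike 𝕜] [Fintype ι] [DecidableEq ι] [Fintype κ]
    [DecidableEq κ] [MeasurableSpace E] (ν : Measure E) [SigmaFinite ν]
    (r : ι → E → 𝕜) (f : ι ⊕ κ → E → 𝕜) (B : κ → ι ⊕ κ → 𝕜)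
    (h_integrable : ∀ a c, Integrable (fun x => r a x * f c x) ν) :
    ∫ z : ι → E, (Matrix.of (fun l a => r a (z l))).det *
        (Matrix.of (Sum.elim (fun l c => f c (z l)) B)).det ∂(Measure.pi fun _ => ν) =
      (Fintype.card ι).factorial *
        (Matrix.of (Sum.elim (fun a c => ∫ x, r a x * f c x ∂ν) B)).det := by
  have expand : ∀ z : ι → E, (Matrix.of (fun l a => r a (z l))).det *
        (Matrix.of (Sum.elim (fun l c => f c (z l)) B)).det =
      ∑ τ : Equiv.Perm ι, ((Equiv.Perm.sign τ : ℤ) : 𝕜) *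
        (Matrix.of (Sum.elim (fun l c => r (τ l) (z l) * f c (z l)) B)).det := by
    intro z
    rw [← Matrix.det_transpose, Matrix.det_apply', Finset.sum_mul]
    refine Finset.sum_congr rfl fun τ _ => ?_
    rw [mul_assoc]
    congr 1
    have := Matrix.det_mul_column (Sum.elim (fun l => r (τ l) (z l)) (fun _ : κ => (1 : 𝕜)))
      (Matrix.of (Sum.elim (fun l c => f c (z l)) B))
    rw [Fintype.prod_sum_type] at this
    simp only [Sum.elim_inl, Sum.elim_inr, Finset.prod_const_one, mul_one] at this
    simp only [Matrix.transpose_apply, Matrix.of_apply]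
    rw [← this]
    congr 1
    ext (l | s) c <;> simp
  simp_rw [expand]
  have H := fun τ : Equiv.Perm ι => integral_det_rows ν
    (fun l c x => r (τ l) x * f c x) B (fun l c => h_integrable (τ l) c)
  rw [integral_finsetSum _ fun τ _ => (H τ).1.const_mul _]
  simp_rw [integral_const_mul, (H _).2]
  rw [Finset.sum_congr rfl (g := fun _ =>
    (Matrix.of (Sum.elim (fun a c => ∫ x, r a x * f c x ∂ν) B)).det)]
  · rw [Finset.sum_const, Finset.card_univ, Fintype.card_perm, nsmul_eq_mul]
  · intro τ _
    have h := Matrix.det_permute (Equiv.sumCongr τ (Equiv.refl κ))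
      (Matrix.of (Sum.elim (fun a c => ∫ x, r a x * f c x ∂ν) B))
    have hs : Equiv.Perm.sign (Equiv.sumCongr τ (Equiv.refl κ)) = Equiv.Perm.sign τ := by
      have := Equiv.Perm.sign_sumCongr τ (1 : Equiv.Perm κ)
      rw [Equiv.Perm.sign_one, mul_one] at this
      exact this
    rw [hs] at h
    have h' : (Matrix.of (Sum.elim (fun l c => ∫ x, r (τ l) x * f c x ∂ν) B)) =
      (Matrix.of (Sum.elim (fun a c => ∫ x, r a x * f c x ∂ν) B)).submatrix
        (Equiv.sumCongr τ (Equiv.refl κ)) id := by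
      ext (l | s) c <;> simp
    rw [h', h, ← mul_assoc, ← Int.cast_mul, ← Units.val_mul, Int.units_mul_self]
    simp

theorem det_sum_elim_fromBlocks_zero {R ι κ : Type*} [CommRing R] [Fintype ι] [DecidableEq ι]
    [Fintype κ] [DecidableEq κ] (A : ι → ι ⊕ κ → R) (B : κ → ι ⊕ κ → R)
    (h : ∀ l s, A l (Sum.inr s) = 0) :
    (Matrix.of (Sum.elim A B)).det =
      (Matrix.of fun l a => A l (Sum.inl a)).det * (Matrix.of fun s t => B s (Sum.inr t)).det := by
  rw [← Matrix.det_fromBlocks_zero₁₂ _ (Matrix.of fun s a => B s (Sum.inl a))]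
  congr 1
  ext (l | s) (a | t) <;> simp [h]

open Polynomial in
/-- The average of products of characteristic polynomials as a confluent determinant of
orthogonal polynomials. -/
theorem christoffel_confluent {N m : ℕ} (n : Fin m → ℕ) (x : Fin m → ℝ) (ν : Measure ℝ)
    [SigmaFinite ν] (w : ℝ → ℝ) (P : ℕ → ℝ[X]) (hP : ∀ k, (P k).Monic)
    (hd : ∀ k, (P k).natDegree = k) (hw : ∀ k : ℕ, Integrable (fun y => y ^ k * w y) ν)
    (horth : ∀ k a : ℕ, a < k → ∫ y, y ^ a * w y * (P k).eval y ∂ν = 0) :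
    (∫ z : Fin N → ℝ, (Matrix.vandermonde z).det * (∏ l, w (z l)) *
        ((Matrix.vandermonde z).det * ∏ i, (∏ l, (x i - z l)) ^ n i) ∂(Measure.pi fun _ => ν)) *
      ((∏ i, ∏ l : Fin (n i), ((l : ℕ).factorial : ℝ)) *
        ∏ j : Fin m, ∏ k ∈ Finset.Ioi j, (x k - x j) ^ (n j * n k)) =
    (∫ z : Fin N → ℝ, (Matrix.vandermonde z).det * (∏ l, w (z l)) *
        (Matrix.vandermonde z).det ∂(Measure.pi fun _ => ν)) *
      (Matrix.of fun s t : Σ i, Fin (n i) =>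
        (derivative^[s.2] (P (N + finSigmaFinEquiv t))).eval (x s.1)).det := by
  classical
  set σ := Σ i, Fin (n i)
  let e : Fin N ⊕ σ ≃ Fin (N + ∑ i, n i) :=
    (Equiv.sumCongr (Equiv.refl _) finSigmaFinEquiv).trans finSumFinEquiv
  have hel : ∀ j, (e (Sum.inl j) : ℕ) = j := fun j => by
    simp [e, -finSigmaFinEquiv_apply]
  have her : ∀ s, (e (Sum.inr s) : ℕ) = N + finSigmaFinEquiv s := fun s => by
    simp [e, -finSigmaFinEquiv_apply]
  let p : Fin N ⊕ σ → ℝ[X] := Sum.elim (fun j => X ^ (j : ℕ)) fun t => P (N + finSigmaFinEquiv t)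
  have hpm : ∀ c, (p c).Monic := by
    rintro (j | t)
    · exact monic_X_pow _
    · exact hP _
  have hpd : ∀ c, (p c).natDegree = e c := by
    rintro (j | t)
    · rw [hel]; exact natDegree_X_pow _
    · rw [her]; exact hd _
  let B : σ → Fin N ⊕ σ → ℝ := fun s c => derivFunctional 1 (x s.1) s.2 (p c)
  have hdv : ∀ z : Fin N → ℝ, (Matrix.of fun l a : Fin N => z l ^ (a : ℕ) * w (z l)).det =
      (Matrix.vandermonde z).det * ∏ l, w (z l) := by
    intro z
    rw [mul_comm, ← Matrix.det_mul_column]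
    congr 1
    ext l a
    simp [Matrix.vandermonde_apply, mul_comm]
  have pointwise : ∀ z : Fin N → ℝ,
      (Matrix.of (Sum.elim (fun l c => (p c).eval (z l)) B)).det =
        ((Matrix.vandermonde z).det * ∏ i, (∏ l, (x i - z l)) ^ n i) *
        ((∏ i, ∏ l : Fin (n i), ((l : ℕ).factorial : ℝ)) *
        ∏ j : Fin m, ∏ k ∈ Finset.Ioi j, (x k - x j) ^ (n j * n k)) := by
    intro z
    let Q : ℝ[X] := ∏ l, (X - C (z l))
    have hQ : Q.Monic := monic_prod_of_monic _ _ fun _ _ => monic_X_sub_C _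
    have hQd : Q.natDegree = N := by
      rw [natDegree_prod_of_monic _ _ fun _ _ => monic_X_sub_C _]; simp
    have hQz : ∀ l, Q.eval (z l) = 0 := fun l => by
      rw [eval_prod]; exact Finset.prod_eq_zero (Finset.mem_univ l) (by simp)
    let φ : Fin N ⊕ σ → ℝ[X] →ₗ[ℝ] ℝ :=
      Sum.elim (fun l => leval (z l)) fun s => derivFunctional 1 (x s.1) s.2
    have h1 : (Matrix.of (Sum.elim (fun l c => (p c).eval (z l)) B)) =
        Matrix.of fun r c => φ r (p c) := by
      ext (l | s) c <;> simp [φ, B]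
    let p' : Fin N ⊕ σ → ℝ[X] :=
      Sum.elim (fun j => X ^ (j : ℕ)) fun t => Q * X ^ (finSigmaFinEquiv t : ℕ)
    rw [h1, det_functional_monic_congr e φ p p' hpm hpd]
    · have h2 : (Matrix.of fun r c => φ r (p' c)) =
          Matrix.of (Sum.elim (fun l c => (p' c).eval (z l))
            fun s c => derivFunctional 1 (x s.1) s.2 (p' c)) := by
        ext (l | s) c <;> simp [φ]
      rw [h2, det_sum_elim_fromBlocks_zero _ _ fun l s => by simp [p', hQz]]
      have h3 := det_confluent (n := n) x Q
      have h4 : ∀ i, Q.eval (x i) = ∏ l, (x i - z l) := fun i => by simp [Q, eval_prod]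
      simp only [h4] at h3
      have h5 : (Matrix.of fun s t : σ => derivFunctional 1 (x s.1) s.2 (p' (Sum.inr t))) =
        Matrix.of fun r c : Σ i, Fin (n i) =>
          derivFunctional Q (x r.1) r.2 (X ^ (finSigmaFinEquiv c : ℕ)) := by
        ext s t
        simp only [Matrix.of_apply, derivFunctional_apply, p', Sum.elim_inr, one_mul]
      have h6 : (Matrix.of fun l a : Fin N => (p' (Sum.inl a)).eval (z l)) =
          Matrix.vandermonde z := by
        ext l a; simp [p', Matrix.vandermonde_apply]
      rw [h5, h3, h6]
      ring
    · rintro (j | t)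
      · exact monic_X_pow _
      · exact hQ.mul (monic_X_pow _)
    · rintro (j | t)
      · rw [hel]; exact natDegree_X_pow _
      · rw [her]
        change (Q * X ^ (finSigmaFinEquiv t : ℕ)).natDegree = _
        rw [hQ.natDegree_mul (monic_X_pow _), natDegree_X_pow, hQd]
  have h_integrable : ∀ (a : Fin N) (q : ℝ[X]),
      Integrable (fun y => y ^ (a : ℕ) * w y * q.eval y) ν := by
    intro a q
    simp_rw [eval_eq_sum_range, Finset.mul_sum]
    refine integrable_finsetSum _ fun k _ => ?_
    have := (hw (a + k)).const_mul (q.coeff k)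
    refine this.congr (Filter.Eventually.of_forall fun y => ?_)
    simp only [pow_add]
    ring
  have main := integral_det_mul_det ν (fun (a : Fin N) y => y ^ (a : ℕ) * w y)
    (fun c y => (p c).eval y) B (fun a c => h_integrable a (p c))
  have base := integral_det_mul_det ν (fun (a : Fin N) y => y ^ (a : ℕ) * w y)
    (fun c : Fin N ⊕ σ => Sum.elim (fun (j : Fin N) (y : ℝ) => y ^ (j : ℕ)) (fun _ _ => 0) c)
    (fun s c => Sum.elim (fun _ => 0) (fun t => if s = t then 1 else 0) c) (by
      rintro a (j | t)
      · simpa using h_integrable a (X ^ (j : ℕ))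
      · simp)
  have hone : (Matrix.of fun s t : σ => if s = t then (1 : ℝ) else 0).det = 1 := by
    rw [← Matrix.det_one (n := σ)]; congr 1
    ext s t; simp [Matrix.one_apply]
  rw [det_sum_elim_fromBlocks_zero _ _ (fun l s => by simp)] at base
  simp_rw [det_sum_elim_fromBlocks_zero (fun (l : Fin N) (c : Fin N ⊕ σ) =>
    Sum.elim (fun (j : Fin N) (y : ℝ) => y ^ (j : ℕ)) (fun _ _ => 0) c _) _ (fun l s => by simp)]
    at base
  simp only [Sum.elim_inl, Sum.elim_inr, hone, mul_one, hdv] at base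
  simp_rw [pointwise, hdv] at main
  rw [det_sum_elim_fromBlocks_zero _ _ (fun l s => horth _ _ (by have := l.2; omega))] at main
  simp_rw [← mul_assoc _ _ ((∏ i, ∏ l : Fin (n i), ((l : ℕ).factorial : ℝ)) *
        ∏ j : Fin m, ∏ k ∈ Finset.Ioi j, (x k - x j) ^ (n j * n k))] at main
  rw [integral_mul_const] at main
  have hV : ∀ z : Fin N → ℝ, (Matrix.of fun l a : Fin N => z l ^ (a : ℕ)) =
      Matrix.vandermonde z := fun z => by ext l a; simp [Matrix.vandermonde_apply]
  simp_rw [hV] at base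
  rw [main, base, mul_assoc]
  congr 2
  · simp [p]
  · congr 1
    ext s t
    simp [B, p, derivFunctional_apply]

/-- Coefficients of the monic Laguerre polynomials for the weight `x ^ α * exp (-c * x)`. -/
noncomputable def laguerreCoeff (α c : ℝ) (n k : ℕ) : ℝ :=
  (-1) ^ (n - k) * n.choose k * c⁻¹ ^ (n - k) * ∏ i ∈ Finset.range (n - k), (α + n - i)

open Polynomial in
/-- Monic Laguerre polynomials for the weight `x ^ α * exp (-c * x)`. -/
noncomputable def laguerreMonic (α c : ℝ) (n : ℕ) : ℝ[X] :=
  ∑ k ∈ Finset.range (n + 1), C (laguerreCoeff α c n k) * X ^ k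

open Polynomial in
theorem laguerreMonic_coeff (α c : ℝ) (n k : ℕ) :
    (laguerreMonic α c n).coeff k = if k ≤ n then laguerreCoeff α c n k else 0 := by
  simp [laguerreMonic, Polynomial.finsetSum_coeff, Polynomial.coeff_X_pow]

open Polynomial in
theorem laguerreMonic_natDegree (α c : ℝ) (n : ℕ) : (laguerreMonic α c n).natDegree = n := by
  refine natDegree_eq_of_le_of_coeff_ne_zero ?_ ?_
  · rw [natDegree_le_iff_coeff_eq_zero]
    intro k hk
    rw [laguerreMonic_coeff, if_neg (by omega)]
  · simp [laguerreMonic_coeff, laguerreCoeff]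

open Polynomial in
theorem laguerreMonic_monic (α c : ℝ) (n : ℕ) : (laguerreMonic α c n).Monic := by
  rw [Monic, leadingCoeff, laguerreMonic_natDegree]
  simp [laguerreMonic_coeff, laguerreCoeff]

theorem Gamma_eq_prod_mul_Gamma_sub (x : ℝ) (r : ℕ) (h : (r : ℝ) < x + 1) :
    Real.Gamma (x + 1) = (∏ i ∈ Finset.range r, (x - i)) * Real.Gamma (x + 1 - r) := by
  induction r with
  | zero => simp
  | succ r ih =>
    push_cast at h
    rw [ih (by linarith), Finset.prod_range_succ, mul_assoc]
    congr 1
    rw [show x + 1 - (r : ℝ) = (x - r) + 1 by ring, Real.Gamma_add_one (by linarith)]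
    congr 2
    push_cast
    ring

theorem Gamma_add_nat_eq_prod (x : ℝ) (r : ℕ) (h : 0 < x) :
    Real.Gamma (x + r) = (∏ i ∈ Finset.range r, (x + i)) * Real.Gamma x := by
  induction r with
  | zero => simp
  | succ r ih =>
    rw [Finset.prod_range_succ, mul_right_comm, ← ih, mul_comm]
    push_cast
    rw [← add_assoc, Real.Gamma_add_one (by positivity)]

theorem laguerre_moment_integrable {α c : ℝ} (hα : -1 < α) (hc : 0 < c) (k : ℕ) :
    Integrable (fun x : ℝ => x ^ k * (x ^ α * Real.exp (-c * x)))
      (volume.restrict (Set.Ioi 0)) := by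
  have h := integrableOn_rpow_mul_exp_neg_mul_rpow (p := 1) (s := α + k) (b := c)
    (by have : (0 : ℝ) ≤ k := k.cast_nonneg
        linarith) one_pos hc
  refine h.congr_fun (fun x hx => ?_) measurableSet_Ioi
  have hx : 0 < x := hx
  simp only [Real.rpow_one]
  rw [Real.rpow_add hx, Real.rpow_natCast]
  ring

theorem laguerre_moment {α c : ℝ} (hα : -1 < α) (hc : 0 < c) (k : ℕ) :
    ∫ x in Set.Ioi (0 : ℝ), x ^ k * (x ^ α * Real.exp (-c * x)) =
      (1 / c) ^ (α + k + 1) * Real.Gamma (α + k + 1) := by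
  rw [← Real.integral_rpow_mul_exp_neg_mul_Ioi
    (by have : (0 : ℝ) ≤ k := k.cast_nonneg
        linarith) hc]
  refine setIntegral_congr_fun measurableSet_Ioi fun x hx => ?_
  have hx : 0 < x := hx
  simp only [add_sub_cancel_right]
  rw [Real.rpow_add hx, Real.rpow_natCast, neg_mul]
  ring

open Polynomial in
theorem sum_alternating_choose_mul_prod_eq_zero (b : ℝ) {n a : ℕ} (h : a < n) :
    ∑ k ∈ Finset.range (n + 1), (-1 : ℝ) ^ (n - k) * n.choose k *
      ∏ i ∈ Finset.range a, (b + k + i) = 0 := by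
  have hdeg : (∏ i ∈ Finset.range a, (X + C (b + (i : ℝ)))).natDegree < n := by
    rw [natDegree_prod_of_monic _ _ fun _ _ => monic_X_add_C _]
    simp_rw [natDegree_X_add_C]
    simpa using h
  have h0 := congr_fun (Polynomial.fwdDiff_iter_eq_zero_of_degree_lt hdeg) 0
  rw [fwdDiff_iter_eq_sum_shift] at h0
  rw [Pi.zero_apply] at h0
  rw [← h0]
  refine Finset.sum_congr rfl fun k _ => ?_
  rw [zsmul_eq_mul]
  push_cast
  congr 1
  rw [eval_prod]
  refine Finset.prod_congr rfl fun i _ => ?_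
  simp
  ring

theorem laguerreMonic_orthogonal {α c : ℝ} (hα : -1 < α) (hc : 0 < c) {n a : ℕ} (h : a < n) :
    ∫ x in Set.Ioi (0 : ℝ), x ^ a * (x ^ α * Real.exp (-c * x)) * (laguerreMonic α c n).eval x
      = 0 := by
  have e1 : ∀ x : ℝ, x ^ a * (x ^ α * Real.exp (-c * x)) * (laguerreMonic α c n).eval x =
      ∑ k ∈ Finset.range (n + 1),
        laguerreCoeff α c n k * (x ^ (a + k) * (x ^ α * Real.exp (-c * x))) := by
    intro x
    simp only [laguerreMonic, Polynomial.eval_finsetSum, Polynomial.eval_mul, Polynomial.eval_C,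
      Polynomial.eval_pow, Polynomial.eval_X, Finset.mul_sum, pow_add]
    exact Finset.sum_congr rfl fun k _ => by ring
  simp_rw [e1]
  rw [integral_finsetSum _ fun k _ => (laguerre_moment_integrable hα hc (a + k)).const_mul _]
  simp_rw [integral_const_mul, laguerre_moment hα hc]
  rw [← mul_zero ((1 / c) ^ (α + n + a + 1) * Real.Gamma (α + n + 1)),
    ← sum_alternating_choose_mul_prod_eq_zero (α + 1) h, Finset.mul_sum]
  refine Finset.sum_congr rfl fun k hk => ?_
  have hkn : k ≤ n := by simpa [Nat.lt_succ_iff] using hk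
  have hk0 : (0 : ℝ) ≤ k := k.cast_nonneg
  have hsub : ((n - k : ℕ) : ℝ) = n - k := by rw [Nat.cast_sub hkn]
  have g1 := Gamma_eq_prod_mul_Gamma_sub (α + n) (n - k) (by rw [hsub]; linarith)
  rw [hsub, show α + n + 1 - ((n : ℝ) - k) = α + 1 + k by ring] at g1
  have g2 := Gamma_add_nat_eq_prod (α + 1 + k) a (by linarith)
  have g3 : (1 / c) ^ (α + n + a + 1) = c⁻¹ ^ (n - k) * (1 / c) ^ (α + k + a + 1) := by
    rw [one_div, ← Real.rpow_natCast, ← Real.rpow_add (inv_pos.2 hc), hsub]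
    congr 1
    ring
  rw [g1, g3, Nat.cast_add, show α + ((a : ℝ) + k) + 1 = α + 1 + k + a by ring, g2,
    laguerreCoeff, show α + k + a + 1 = α + 1 + k + a by ring]
  ring

theorem iteratedDeriv_add_two_cpow (β : ℂ) (r : ℕ) (z : ℂ) (hz : 0 < (z + 2).re) :
    iteratedDeriv r (fun z : ℂ => (z + 2) ^ β) z =
      (∏ i ∈ Finset.range r, (β - i)) * (z + 2) ^ (β - r) := by
  induction r generalizing z with
  | zero => simp
  | succ r ih =>
    rw [iteratedDeriv_succ]
    have hev : iteratedDeriv r (fun z : ℂ => (z + 2) ^ β) =ᶠ[nhds z]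
        fun z => (∏ i ∈ Finset.range r, (β - i)) * (z + 2) ^ (β - r) := by
      have : ∀ᶠ w : ℂ in nhds z, 0 < (w + 2).re :=
        (by fun_prop : Continuous fun w : ℂ => (w + 2).re).continuousAt.eventually
          (lt_mem_nhds hz)
      exact this.mono fun w hw => ih w hw
    rw [hev.deriv_eq]
    have hd : HasDerivAt (fun z : ℂ => (z + 2) ^ (β - r)) ((β - r) * (z + 2) ^ (β - r - 1) * 1) z :=
      ((hasDerivAt_id z).add_const 2).cpow_const (Or.inl hz)
    rw [(hd.const_mul _).deriv, Finset.prod_range_succ]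
    push_cast
    rw [sub_sub]
    ring

theorem analyticAt_add_two_cpow (β : ℂ) (z : ℂ) (hz : 0 < (z + 2).re) :
    AnalyticAt ℂ (fun z : ℂ => (z + 2) ^ β) z :=
  AnalyticAt.cpow (by fun_prop) analyticAt_const (Or.inl hz)

theorem circleIntegral_eq_integral_Ioc (f : ℂ → ℂ) :
    circleIntegral f 0 1 = ∫ θ in Set.Ioc (0 : ℝ) (2 * Real.pi),
      Complex.I * Complex.exp (Complex.I * θ) * f (Complex.exp (Complex.I * θ)) := by
  rw [circleIntegral, intervalIntegral.integral_of_le (by positivity)]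
  refine integral_congr_ae (Filter.Eventually.of_forall fun θ => ?_)
  simp only [deriv_circleMap, circleMap_zero, smul_eq_mul]
  simp [mul_comm]

theorem circleIntegral_pow_mul_div (l n : ℕ) (h : ℂ → ℂ)
    (hh : ∀ z ∈ Metric.closedBall (0 : ℂ) 1, AnalyticAt ℂ h z) :
    circleIntegral (fun z => z ^ l * h z * (z ^ (n + 1))⁻¹) 0 1 =
      if l ≤ n then 2 * Real.pi * Complex.I / n.factorial *
        (n.choose l * l.factorial * iteratedDeriv (n - l) h 0) else 0 := by
  have han : ∀ z ∈ Metric.closedBall (0 : ℂ) 1, AnalyticAt ℂ (fun z => z ^ l * h z) z :=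
    fun z hz => (by fun_prop : AnalyticAt ℂ (fun z : ℂ => z ^ l) z).mul (hh z hz)
  have key := DifferentiableOn.circleIntegral_one_div_sub_center_pow_smul
    (f := fun z => z ^ l * h z) (c := 0) one_pos n
    (fun z hz => (han z hz).differentiableAt.differentiableWithinAt)
  have h0 : (0 : ℂ) ∈ Metric.closedBall (0 : ℂ) 1 := by simp
  have e : (fun z => z ^ l * h z * (z ^ (n + 1))⁻¹) =
      fun z => (1 / (z - 0) ^ (n + 1)) • (z ^ l * h z) := by
    ext z; simp [mul_comm]
  rw [e, key, iteratedDeriv_fun_mul (by fun_prop) (hh 0 h0).contDiffAt]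
  simp_rw [iteratedDeriv_fun_pow_zero]
  split_ifs with hl
  · rw [Finset.sum_eq_single l]
    · simp
    · intro i _ hi
      simp [hi]
    · intro hi
      simp at hi
      omega
  · rw [Finset.sum_eq_zero, smul_zero]
    intro i hi
    have : i ≠ l := by simp at hi; omega
    simp [this]

theorem iteratedDeriv_exp_mul_cpow (b β : ℂ) (r : ℕ) :
    iteratedDeriv r (fun z : ℂ => Complex.exp (b * z) * (z + 2) ^ β) 0 =
      ∑ j ∈ Finset.range (r + 1), r.choose j * b ^ j *
        ((∏ i ∈ Finset.range (r - j), (β - i)) * 2 ^ (β - (r - j : ℕ))) := by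
  rw [iteratedDeriv_fun_mul (by fun_prop) (analyticAt_add_two_cpow β 0 (by simp)).contDiffAt]
  refine Finset.sum_congr rfl fun j _ => ?_
  rw [iteratedDeriv_cexp_const_mul, iteratedDeriv_add_two_cpow _ _ _ (by simp)]
  simp

open Polynomial in
theorem laguerreMonic_iterate_derivative_eval (α c μ : ℝ) (n l : ℕ) :
    (derivative^[l] (laguerreMonic α c n)).eval μ = if l ≤ n then
      ∑ j ∈ Finset.range (n - l + 1),
        laguerreCoeff α c n (l + j) * (l + j).descFactorial l * μ ^ j else 0 := by
  split_ifs with hl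
  · have : (derivative^[l] (laguerreMonic α c n)).natDegree < n - l + 1 := by
      have := natDegree_iterate_derivative (laguerreMonic α c n) l
      rw [laguerreMonic_natDegree] at this
      omega
    rw [eval_eq_sum_range' this]
    refine Finset.sum_congr rfl fun j hj => ?_
    have hj : j ≤ n - l := by simpa [Nat.lt_succ_iff] using hj
    rw [coeff_iterate_derivative, laguerreMonic_coeff, if_pos (by omega), nsmul_eq_mul,
      add_comm j l]
    ring
  · rw [iterate_derivative_eq_zero (by rw [laguerreMonic_natDegree]; omega), eval_zero]

open Polynomial in
theorem laguerreMonic_contour (α μ : ℝ) {c : ℝ} (hc : 0 < c) (n l : ℕ) :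
    (((derivative^[l] (laguerreMonic α c n)).eval μ : ℝ) : ℂ) =
      (-1) ^ n * n.factorial * (c : ℂ)⁻¹ ^ n * (2 : ℂ) ^ (-(α : ℂ)) /
        (2 * Real.pi * Complex.I) *
      ∫ θ in Set.Ioc (0 : ℝ) (2 * Real.pi),
        Complex.I * Complex.exp (Complex.I * θ) *
          ((-(c / 2) * Complex.exp (Complex.I * θ)) ^ l *
            (Complex.exp (-(c / 2) * μ * Complex.exp (Complex.I * θ)) *
              (Complex.exp (Complex.I * θ) + 2) ^ ((α : ℂ) + n)) *
            (Complex.exp (Complex.I * θ) ^ (n + 1))⁻¹) := by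
  rw [← circleIntegral_eq_integral_Ioc (fun z => (-(c / 2) * z) ^ l *
            (Complex.exp (-(c / 2) * μ * z) * (z + 2) ^ ((α : ℂ) + n)) * (z ^ (n + 1))⁻¹)]
  have e : (fun z : ℂ => (-(c / 2) * z) ^ l *
            (Complex.exp (-(c / 2) * μ * z) * (z + 2) ^ ((α : ℂ) + n)) * (z ^ (n + 1))⁻¹) =
      fun z => (-(c / 2) : ℂ) ^ l * (z ^ l * (fun z => Complex.exp (-(c / 2) * μ * z) *
        (z + 2) ^ ((α : ℂ) + n)) z * (z ^ (n + 1))⁻¹) := by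
    ext z; simp only [mul_pow]; ring
  rw [e, circleIntegral.integral_const_mul, circleIntegral_pow_mul_div,
    laguerreMonic_iterate_derivative_eval]
  · split_ifs with hl
    · rw [iteratedDeriv_exp_mul_cpow]
      have hpi : (2 * Real.pi * Complex.I : ℂ) ≠ 0 := Complex.two_pi_I_ne_zero
      have hnf : (n.factorial : ℂ) ≠ 0 := by exact_mod_cast n.factorial_ne_zero
      have hc0 : (c : ℂ) ≠ 0 := by exact_mod_cast hc.ne'
      push_cast
      simp only [Finset.mul_sum]
      refine Finset.sum_congr rfl fun j hj => ?_
      have hj : j ≤ n - l := by simpa [Nat.lt_succ_iff] using hj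
      obtain ⟨k, rfl⟩ : ∃ k, n = l + j + k := ⟨n - l - j, by omega⟩
      rw [laguerreCoeff]
      have h1 : l + j + k - (l + j) = k := by omega
      have h2 : l + j + k - l - j = k := by omega
      have h3 : ((l + j + k).choose (l + j) : ℂ) * (l + j).descFactorial l =
          (l + j + k).choose l * l.factorial * (l + j + k - l).choose j := by
        have := Nat.choose_mul (n := l + j + k) (k := l + j) (s := l) (by omega)
        rw [Nat.descFactorial_eq_factorial_mul_choose]
        have h := congrArg (Nat.cast : ℕ → ℂ) this
        push_cast at h ⊢
        rw [show l + j - l = j by omega] at h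
        linear_combination (l.factorial : ℂ) * h
      have h4 : (2 : ℂ) ^ ((α : ℂ) + (l + j + k : ℕ) - (k : ℕ)) = 2 ^ (α : ℂ) * 2 ^ l * 2 ^ j := by
        rw [show (α : ℂ) + (l + j + k : ℕ) - (k : ℕ) = α + (l + j : ℕ) by push_cast; ring,
          Complex.cpow_add _ _ two_ne_zero, Complex.cpow_natCast, pow_add, mul_assoc]
      have h5 : (2 : ℂ) ^ (-(α : ℂ)) * 2 ^ (α : ℂ) = 1 := by
        rw [← Complex.cpow_add _ _ two_ne_zero]; simp
      rw [h1, h2, h4]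
      push_cast at h3 ⊢
      have h6 : (-1 : ℂ) ^ (l + j + k) * (c : ℂ)⁻¹ ^ (l + j + k) * (-(c / 2)) ^ l *
          (-(c / 2) * μ) ^ j * 2 ^ l * 2 ^ j = (-1) ^ k * (c : ℂ)⁻¹ ^ k * μ ^ j := by
        have h7 : (-1 : ℂ) * (c : ℂ)⁻¹ * (-(c / 2)) * 2 = 1 := by field_simp
        calc _ = ((-1 : ℂ) * (c : ℂ)⁻¹ * (-(c / 2)) * 2) ^ l *
              ((-1 : ℂ) * (c : ℂ)⁻¹ * (-(c / 2)) * 2) ^ j *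
              ((-1) ^ k * (c : ℂ)⁻¹ ^ k * μ ^ j) := by
              simp only [pow_add, mul_pow]; ring
          _ = _ := by rw [h7]; simp
      have h8 : ((l + j + k).factorial : ℂ) / (2 * Real.pi * Complex.I) *
          (2 * Real.pi * Complex.I / (l + j + k).factorial) = 1 := by
        field_simp
      have h9 : ∀ X : ℂ, X * 1 * 1 = X * ((2 : ℂ) ^ (-(α : ℂ)) * 2 ^ (α : ℂ)) *
          (((l + j + k).factorial : ℂ) / (2 * Real.pi * Complex.I) *
          (2 * Real.pi * Complex.I / (l + j + k).factorial)) := by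
        intro X
        rw [h5, h8]
      generalize (∏ x ∈ range k, ((α : ℂ) + (l + j + k) - x)) = T
      calc _ = (((l + j + k).choose (l + j) : ℂ) * (l + j).descFactorial l) *
            ((-1) ^ k * (c : ℂ)⁻¹ ^ k * μ ^ j) * T * 1 * 1 := by ring
        _ = _ := by
          rw [h3, ← h6, h9]
          ring
    · simp
  · intro z hz
    have hz : ‖z‖ ≤ 1 := by simpa using hz
    have : 0 < (z + 2).re := by
      have := (abs_le.1 ((Complex.abs_re_le_norm z).trans hz)).1
      simp only [Complex.add_re, Complex.re_ofNat]
      linarith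
    exact (by fun_prop : AnalyticAt ℂ (fun z : ℂ => Complex.exp (-(c / 2) * μ * z)) z).mul
      (analyticAt_add_two_cpow _ z this)

theorem measurePreserving_comp_equiv {ι E : Type*} [Fintype ι] [MeasurableSpace E]
    (ν : Measure E) [SigmaFinite ν] (e : ι ≃ ι) :
    MeasurePreserving (fun θ : ι → E => θ ∘ e) (Measure.pi fun _ => ν) (Measure.pi fun _ => ν) := by
  have h := measurePreserving_piCongrLeft (α := fun _ : ι => E) (fun _ => ν) e.symm
  convert h using 1
  ext θ s
  have := Equiv.piCongrLeft_apply_apply (fun _ : ι => E) e.symm θ (e s)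
  rw [e.symm_apply_apply] at this
  exact this.symm

theorem integral_mul_prod_det_vandermonde_sq {m : ℕ} {n : Fin m → ℕ} {E : Type*}
    [MeasurableSpace E] (ν : Measure E) [SigmaFinite ν] (z : E → ℂ)
    (W : ((Σ i, Fin (n i)) → E) → ℂ)
    (hW : ∀ (ρ : ∀ i, Equiv.Perm (Fin (n i))) θ, W (θ ∘ Equiv.sigmaCongrRight ρ) = W θ)
    (h_integrable : Integrable (fun θ => W θ *
      (∏ i, (Matrix.vandermonde fun l : Fin (n i) => z (θ ⟨i, l⟩)).det) *
      ∏ i, ∏ l : Fin (n i), z (θ ⟨i, l⟩) ^ (l : ℕ)) (Measure.pi fun _ => ν)) :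
    ∫ θ, W θ * (∏ i, (Matrix.vandermonde fun l : Fin (n i) => z (θ ⟨i, l⟩)).det) *
        (∏ i, (Matrix.vandermonde fun l : Fin (n i) => z (θ ⟨i, l⟩)).det)
        ∂(Measure.pi fun _ => ν) =
      (∏ i, ((n i).factorial : ℂ)) *
      ∫ θ, W θ * (∏ i, (Matrix.vandermonde fun l : Fin (n i) => z (θ ⟨i, l⟩)).det) *
        (∏ i, ∏ l : Fin (n i), z (θ ⟨i, l⟩) ^ (l : ℕ)) ∂(Measure.pi fun _ => ν) := by
  set F : ((Σ i, Fin (n i)) → E) → ℂ := fun θ => W θ *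
      (∏ i, (Matrix.vandermonde fun l : Fin (n i) => z (θ ⟨i, l⟩)).det) *
      ∏ i, ∏ l : Fin (n i), z (θ ⟨i, l⟩) ^ (l : ℕ) with hF
  have hmp : ∀ ρ : ∀ i, Equiv.Perm (Fin (n i)), MeasurePreserving
      (fun θ : (Σ i, Fin (n i)) → E => θ ∘ Equiv.sigmaCongrRight ρ)
      (Measure.pi fun _ => ν) (Measure.pi fun _ => ν) :=
    fun ρ => measurePreserving_comp_equiv ν _
  have hsum : ∀ θ, W θ * (∏ i, (Matrix.vandermonde fun l : Fin (n i) => z (θ ⟨i, l⟩)).det) *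
        (∏ i, (Matrix.vandermonde fun l : Fin (n i) => z (θ ⟨i, l⟩)).det) =
      ∑ ρ : ∀ i, Equiv.Perm (Fin (n i)), F (θ ∘ Equiv.sigmaCongrRight ρ) := by
    intro θ
    have h1 : ∏ i, (Matrix.vandermonde fun l : Fin (n i) => z (θ ⟨i, l⟩)).det =
        ∑ ρ : ∀ i, Equiv.Perm (Fin (n i)), ∏ i, (((Equiv.Perm.sign (ρ i) : ℤ) : ℂ) *
          ∏ l : Fin (n i), z (θ ⟨i, ρ i l⟩) ^ (l : ℕ)) := by
      simp_rw [Matrix.det_apply', Matrix.vandermonde_apply]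
      rw [Finset.prod_univ_sum, Fintype.piFinset_univ]
    rw [h1, Finset.mul_sum, ← h1]
    refine Finset.sum_congr rfl fun ρ _ => ?_
    simp only [hF, hW, Function.comp_apply, Equiv.sigmaCongrRight_apply]
    have h2 : ∀ i, (Matrix.vandermonde fun l : Fin (n i) => z (θ ⟨i, ρ i l⟩)).det =
        ((Equiv.Perm.sign (ρ i) : ℤ) : ℂ) *
          (Matrix.vandermonde fun l : Fin (n i) => z (θ ⟨i, l⟩)).det :=
      fun i => by
        have := Matrix.det_permute (ρ i) (Matrix.vandermonde fun l : Fin (n i) => z (θ ⟨i, l⟩))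
        rw [← this]
        rfl
    simp_rw [h2, Finset.prod_mul_distrib]
    ring
  have h_integrable' : ∀ ρ : ∀ i, Equiv.Perm (Fin (n i)),
      Integrable (fun θ => F (θ ∘ Equiv.sigmaCongrRight ρ)) (Measure.pi fun _ => ν) :=
    fun ρ => (hmp ρ).integrable_comp_of_integrable h_integrable
  have hval : ∀ ρ : ∀ i, Equiv.Perm (Fin (n i)),
      ∫ θ, F (θ ∘ Equiv.sigmaCongrRight ρ) ∂(Measure.pi fun _ => ν) =
        ∫ θ, F θ ∂(Measure.pi fun _ => ν) := by
    intro ρ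
    have := integral_map (μ := Measure.pi fun _ => ν) (hmp ρ).measurable.aemeasurable (f := F)
      (by rw [(hmp ρ).map_eq]; exact h_integrable.aestronglyMeasurable)
    rw [(hmp ρ).map_eq] at this
    exact this.symm
  simp_rw [hsum]
  rw [integral_finsetSum _ fun ρ _ => h_integrable' ρ]
  simp_rw [hval]
  simp [Fintype.card_pi, Fintype.card_perm]

theorem det_affine_pow {R ι : Type*} [CommRing R] [Fintype ι] [DecidableEq ι] {n : ℕ}
    (e : ι ≃ Fin n) (a b : R) (y : ι → R) :
    (Matrix.of fun s t : ι => (a + b * y s) ^ (e t : ℕ)).det =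
      (∏ t, b ^ (e t : ℕ)) * (Matrix.of fun s t : ι => y s ^ (e t : ℕ)).det := by
  have h : ∀ x : ι → R, (Matrix.of fun s t : ι => x s ^ (e t : ℕ)).det =
      (Matrix.vandermonde (x ∘ e.symm)).det := by
    intro x
    rw [← Matrix.det_submatrix_equiv_self e (Matrix.vandermonde (x ∘ e.symm))]
    congr 1
    ext s t
    simp
  rw [h, h, Matrix.det_vandermonde, Matrix.det_vandermonde]
  rw [Equiv.prod_comp e (fun t => b ^ (t : ℕ))]
  have h2 : ∏ t : Fin n, b ^ (t : ℕ) = ∏ j : Fin n, ∏ k ∈ Ioi j, b := by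
    rw [prod_sigma', ← prod_sigma' univ (fun j => Ioi j) (fun _ _ => b),
      Finset.prod_comm' (t' := univ) (s' := fun k => Iio k) (by simp)]
    simp
  rw [h2]
  simp_rw [← Finset.prod_mul_distrib]
  refine prod_congr rfl fun j _ => prod_congr rfl fun k _ => ?_
  simp only [Function.comp_apply]
  ring

theorem det_vandermonde_inv {K : Type*} [Field K] (q : ℕ) (z : Fin (2 * q) → K)
    (hz : ∀ l, z l ≠ 0) :
    (Matrix.vandermonde fun l => (z l)⁻¹).det =
      (-1) ^ q * (Matrix.vandermonde z).det * ∏ l, (z l)⁻¹ ^ (2 * q - 1) := by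
  rw [Matrix.det_vandermonde, Matrix.det_vandermonde]
  have h1 : ∀ j k, (z k)⁻¹ - (z j)⁻¹ = (-1) * (z k - z j) * ((z j)⁻¹ * (z k)⁻¹) := by
    intro j k
    have := hz j
    have := hz k
    field_simp
    ring
  simp_rw [h1, Finset.prod_mul_distrib]
  have h2 : (∏ j : Fin (2 * q), ∏ _k ∈ Ioi j, (-1 : K)) = (-1) ^ q := by
    simp only [prod_const, Fin.card_Ioi]
    have hs : ∑ j : Fin (2 * q), (2 * q - 1 - (j : ℕ)) = (2 * q - 1) * q := by
      have h := Finset.sum_range_id_mul_two (2 * q)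
      rw [Fin.sum_univ_eq_sum_range (fun j => 2 * q - 1 - j), Finset.sum_range_reflect (fun j => j)]
      nlinarith
    rw [Finset.prod_pow_eq_pow_sum, hs, pow_mul]
    rcases Nat.eq_zero_or_pos q with rfl | hq
    · simp
    · rw [Odd.neg_one_pow ⟨q - 1, by omega⟩]
  have h3 : (∏ j : Fin (2 * q), ∏ k ∈ Ioi j, (z k)⁻¹) = ∏ k : Fin (2 * q), (z k)⁻¹ ^ (k : ℕ) := by
    rw [Finset.prod_comm' (t' := univ) (s' := fun k => Iio k) (by simp)]
    simp
  rw [h2, h3]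
  simp only [prod_const, Fin.card_Ioi]
  rw [← Finset.prod_mul_distrib]
  congr 1
  refine prod_congr rfl fun l _ => ?_
  rw [← pow_add]
  congr 1
  omega

theorem integrable_pi_restrict_Ioc_of_continuous {ι : Type*} [Fintype ι] {a b : ℝ}
    {f : (ι → ℝ) → ℂ} (hf : Continuous f) :
    Integrable f (Measure.pi fun _ : ι => volume.restrict (Set.Ioc a b)) := by
  rw [← Measure.restrict_pi_pi, ← volume_pi]
  refine (hf.integrableOn_Icc (a := fun _ => a) (b := fun _ => b)).mono_set ?_
  rw [← Set.pi_univ_Icc]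
  exact Set.pi_mono fun _ _ => Set.Ioc_subset_Icc_self

theorem exp_I_mul_add_two_re_pos (θ : ℝ) : 0 < (Complex.exp (Complex.I * θ) + 2).re := by
  have h1 : ‖Complex.exp (Complex.I * θ)‖ = 1 := by
    rw [mul_comm]; exact Complex.norm_exp_ofReal_mul_I θ
  have := (abs_le.1 ((Complex.abs_re_le_norm _).trans h1.le)).1
  simp only [Complex.add_re, Complex.re_ofNat]
  linarith

theorem continuous_exp_I_mul_add_two_cpow {X : Type*} [TopologicalSpace X] (α : ℂ) {g : X → ℝ}
    (hg : Continuous g) :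
    Continuous fun x => (Complex.exp (Complex.I * (g x : ℂ)) + 2) ^ α :=
  Continuous.cpow (by fun_prop) continuous_const fun x => Or.inl (exp_I_mul_add_two_re_pos _)

/-- The one-variable integrand in the contour representation of `laguerreMonic`, stripped of the
powers that depend on the row and column of the determinant. -/
noncomputable def contourFactor (α : ℝ) (N : ℕ) (x θ : ℝ) : ℂ :=
  Complex.I * Complex.exp (Complex.I * θ) *
    (Complex.exp (-(2 * N) * x * Complex.exp (Complex.I * θ)) *
      (Complex.exp (Complex.I * θ) + 2) ^ (α : ℂ) * (Complex.exp (Complex.I * θ) + 2) ^ N *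
      (Complex.exp (Complex.I * θ) ^ (N + 1))⁻¹)

theorem continuous_contourFactor (α : ℝ) (N : ℕ) (x : ℝ) {X : Type*} [TopologicalSpace X]
    {g : X → ℝ} (hg : Continuous g) : Continuous fun y => contourFactor α N x (g y) := by
  have := continuous_exp_I_mul_add_two_cpow α hg
  unfold contourFactor
  have h2 : Continuous fun y => (Complex.exp (Complex.I * (g y : ℂ)) ^ (N + 1))⁻¹ :=
    Continuous.inv₀ (by fun_prop) fun y => pow_ne_zero _ (Complex.exp_ne_zero _)
  fun_prop

open Polynomial in
theorem laguerreMonic_contour_affine (α x : ℝ) {N : ℕ} (hN : 1 ≤ N) (k l : ℕ) :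
    (((derivative^[l] (laguerreMonic α (4 * N) (N + k))).eval x : ℝ) : ℂ) =
      (-1) ^ (N + k) * (N + k).factorial * (4 * N : ℂ)⁻¹ ^ (N + k) * (2 : ℂ) ^ (-(α : ℂ)) /
        (2 * Real.pi * Complex.I) *
      ∫ θ in Set.Ioc (0 : ℝ) (2 * Real.pi),
        contourFactor α N x θ * (-(2 * N) * Complex.exp (Complex.I * θ)) ^ l *
          (1 + 2 * (Complex.exp (Complex.I * θ))⁻¹) ^ k := by
  have hc : (0 : ℝ) < 4 * N := by positivity
  rw [laguerreMonic_contour α x hc]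
  push_cast
  congr 1
  refine integral_congr_ae (Filter.Eventually.of_forall fun θ => ?_)
  have hz : Complex.exp (Complex.I * θ) ≠ 0 := Complex.exp_ne_zero _
  have hz2 : Complex.exp (Complex.I * θ) + 2 ≠ 0 := by
    intro h
    have := exp_I_mul_add_two_re_pos θ
    simp [h] at this
  simp only [contourFactor]
  have h4 : -(4 * (N : ℂ) / 2) = -(2 * N) := by ring
  rw [h4, ← Nat.cast_add, Complex.cpow_add _ _ hz2, Complex.cpow_natCast]
  have h5 : 1 + 2 * (Complex.exp (Complex.I * θ))⁻¹ =
      (Complex.exp (Complex.I * θ) + 2) * (Complex.exp (Complex.I * θ))⁻¹ := by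
    field_simp
  rw [h5, mul_pow (Complex.exp (Complex.I * θ) + 2)]
  simp only [← inv_pow]
  ring

theorem integral_det_contour {m : ℕ} (α : ℝ) (N : ℕ) (q : Fin m → ℕ)
    (x : Fin m → ℝ) :
    (∏ i, ((2 * q i).factorial : ℂ)) *
    (Matrix.of fun s t : Σ i, Fin (2 * q i) => ∫ θ in Set.Ioc (0 : ℝ) (2 * Real.pi),
        contourFactor α N (x s.1) θ * (-(2 * N) * Complex.exp (Complex.I * θ)) ^ (s.2 : ℕ) *
          (1 + 2 * (Complex.exp (Complex.I * θ))⁻¹) ^ (finSigmaFinEquiv t : ℕ)).det =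
      (∏ t : Σ i, Fin (2 * q i), (2 : ℂ) ^ (finSigmaFinEquiv t : ℕ)) * (∏ i, (-1) ^ q i) *
      (∏ i, ∏ l : Fin (2 * q i), (-2 * (N : ℂ)) ^ (l : ℕ)) *
      ∫ θ, (∏ s : Σ i, Fin (2 * q i), (contourFactor α N (x s.1) (θ s) *
          (Complex.exp (Complex.I * θ s))⁻¹ ^ (2 * q s.1 - 1))) *
        (∏ i, (Matrix.vandermonde
          fun l : Fin (2 * q i) => Complex.exp (Complex.I * θ ⟨i, l⟩)).det ^ 2) *
        (∏ j : Fin m, ∏ k ∈ Ioi j, ∏ lk : Fin (2 * q k), ∏ lj : Fin (2 * q j),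
          ((Complex.exp (Complex.I * θ ⟨k, lk⟩))⁻¹ - (Complex.exp (Complex.I * θ ⟨j, lj⟩))⁻¹))
        ∂(Measure.pi fun _ => volume.restrict (Set.Ioc (0 : ℝ) (2 * Real.pi))) := by
  set ν : Measure ℝ := volume.restrict (Set.Ioc (0 : ℝ) (2 * Real.pi)) with hν
  set z : ℝ → ℂ := fun θ => Complex.exp (Complex.I * θ) with hz
  have hz0 : ∀ θ, z θ ≠ 0 := fun θ => Complex.exp_ne_zero _
  have hzc : Continuous z := by fun_prop
  have hzi : Continuous fun θ => (z θ)⁻¹ := hzc.inv₀ hz0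
  set X : ((Σ i, Fin (2 * q i)) → ℝ) → ℂ := fun θ =>
    ∏ j : Fin m, ∏ k ∈ Ioi j, ∏ lk : Fin (2 * q k), ∏ lj : Fin (2 * q j),
          ((z (θ ⟨k, lk⟩))⁻¹ - (z (θ ⟨j, lj⟩))⁻¹) with hX
  set W : ((Σ i, Fin (2 * q i)) → ℝ) → ℂ := fun θ =>
    (∏ s : Σ i, Fin (2 * q i), (contourFactor α N (x s.1) (θ s) *
          (z (θ s))⁻¹ ^ (2 * q s.1 - 1))) * X θ with hW
  have hWinv : ∀ (ρ : ∀ i, Equiv.Perm (Fin (2 * q i))) θ,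
      W (θ ∘ Equiv.sigmaCongrRight ρ) = W θ := by
    intro ρ θ
    simp only [hW]
    congr 1
    · exact Equiv.prod_comp (Equiv.sigmaCongrRight ρ) fun s => contourFactor α N (x s.1) (θ s) *
          (z (θ s))⁻¹ ^ (2 * q s.1 - 1)
    · simp only [hX, Function.comp_apply, Equiv.sigmaCongrRight_apply]
      refine prod_congr rfl fun j _ => prod_congr rfl fun k _ => ?_
      exact Fintype.prod_equiv (ρ k) _ _ fun lk => Fintype.prod_equiv (ρ j) _ _ fun lj => rfl
  have hcf : ∀ (y : ℝ) (s : Σ i, Fin (2 * q i)),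
      Continuous fun θ : (Σ i, Fin (2 * q i)) → ℝ => contourFactor α N y (θ s) :=
    fun y s => continuous_contourFactor α N y (continuous_apply s)
  have hzis : ∀ (s : Σ i, Fin (2 * q i)),
      Continuous fun θ : (Σ i, Fin (2 * q i)) → ℝ => (z (θ s))⁻¹ :=
    fun s => hzi.comp (continuous_apply s)
  have hcont : Continuous fun θ => W θ *
      (∏ i, (Matrix.vandermonde fun l : Fin (2 * q i) => z (θ ⟨i, l⟩)).det) *
      ∏ i, ∏ l : Fin (2 * q i), z (θ ⟨i, l⟩) ^ (l : ℕ) := by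
    simp only [hW, hX, Matrix.det_vandermonde]
    fun_prop
  have hsym := integral_mul_prod_det_vandermonde_sq ν z W hWinv
    (integrable_pi_restrict_Ioc_of_continuous hcont)
  have h_integrable : ∀ s t : Σ i, Fin (2 * q i), Integrable (fun θ : ℝ => contourFactor α N (x s.1) θ *
      (-(2 * N) * z θ) ^ (s.2 : ℕ) * (1 + 2 * (z θ)⁻¹) ^ (finSigmaFinEquiv t : ℕ)) ν := by
    intro s t
    have h1 : Continuous fun θ : ℝ => contourFactor α N (x s.1) θ *
      (-(2 * N) * z θ) ^ (s.2 : ℕ) * (1 + 2 * (z θ)⁻¹) ^ (finSigmaFinEquiv t : ℕ) := by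
      have := continuous_contourFactor α N (x s.1) continuous_id
      simp only [id] at this
      fun_prop
    exact h1.integrableOn_Icc.mono_set Set.Ioc_subset_Icc_self
  rw [← integral_det ν _ h_integrable]
  have hdet : ∀ θ : (Σ i, Fin (2 * q i)) → ℝ,
      (Matrix.of fun s t : Σ i, Fin (2 * q i) => contourFactor α N (x s.1) (θ s) *
        (-(2 * N) * z (θ s)) ^ (s.2 : ℕ) *
          (1 + 2 * (z (θ s))⁻¹) ^ (finSigmaFinEquiv t : ℕ)).det =
      (∏ t : Σ i, Fin (2 * q i), (2 : ℂ) ^ (finSigmaFinEquiv t : ℕ)) * (∏ i, (-1) ^ q i) *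
        (∏ i, ∏ l : Fin (2 * q i), (-2 * (N : ℂ)) ^ (l : ℕ)) *
      (W θ * (∏ i, (Matrix.vandermonde fun l : Fin (2 * q i) => z (θ ⟨i, l⟩)).det) *
        ∏ i, ∏ l : Fin (2 * q i), z (θ ⟨i, l⟩) ^ (l : ℕ)) := by
    intro θ
    have h := Matrix.det_mul_column (fun s : Σ i, Fin (2 * q i) =>
      contourFactor α N (x s.1) (θ s) * (-(2 * N) * z (θ s)) ^ (s.2 : ℕ))
      (Matrix.of fun s t => (1 + 2 * (z (θ s))⁻¹) ^ (finSigmaFinEquiv t : ℕ))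
    simp only [Matrix.of_apply] at h
    rw [h, det_affine_pow finSigmaFinEquiv, det_vandermonde_sigma]
    have h2 : ∀ i, (Matrix.vandermonde fun l : Fin (2 * q i) => (z (θ ⟨i, l⟩))⁻¹).det =
      (-1) ^ q i * (Matrix.vandermonde fun l : Fin (2 * q i) => z (θ ⟨i, l⟩)).det *
        ∏ l : Fin (2 * q i), (z (θ ⟨i, l⟩))⁻¹ ^ (2 * q i - 1) :=
      fun i => det_vandermonde_inv (q i) _ fun l => hz0 _
    simp_rw [h2]
    simp only [hW, hX, ← neg_mul, mul_pow, Fintype.prod_sigma, Finset.prod_mul_distrib]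
    ring
  simp_rw [hdet]
  rw [integral_const_mul, mul_left_comm, ← hsym]
  congr 1
  refine integral_congr_ae (Filter.Eventually.of_forall fun θ => ?_)
  simp only [hW, hX, Finset.prod_pow]
  ring

theorem contour_constant (N j : ℕ) (α : ℝ) :
    (-1 : ℂ) ^ (N + j) * ((N + j).factorial : ℂ) * (N : ℂ) ^ (-((N : ℤ) + j)) *
        (((2 : ℝ) ^ (-(2 * (N : ℝ) + (j + 1) + α)) : ℝ) : ℂ) / ((Real.pi : ℂ) * Complex.I) =
      (-1) ^ (N + j) * (N + j).factorial * (4 * N : ℂ)⁻¹ ^ (N + j) * (2 : ℂ) ^ (-(α : ℂ)) /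
        (2 * Real.pi * Complex.I) * 2 ^ j := by
  have h1 : (2 : ℝ) ^ (-(2 * (N : ℝ) + (j + 1) + α)) =
      (4 : ℝ)⁻¹ ^ (N + j) * 2 ^ j * 2⁻¹ * 2 ^ (-α) := by
    have e : -(2 * (N : ℝ) + (j + 1) + α) = -((2 * (N + j) : ℕ) : ℝ) + (j : ℕ) + (-1) + -α := by
      push_cast; ring
    rw [e, Real.rpow_add two_pos, Real.rpow_add two_pos, Real.rpow_add two_pos,
      Real.rpow_neg two_pos.le, Real.rpow_natCast, Real.rpow_natCast, Real.rpow_neg_one, pow_mul,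
      inv_pow]
    norm_num
  have h2 : (2 : ℂ) ^ (-(α : ℂ)) = (((2 : ℝ) ^ (-α) : ℝ) : ℂ) := by
    rw [Complex.ofReal_cpow two_pos.le]; push_cast; rfl
  have h3 : (N : ℂ) ^ (-((N : ℤ) + j)) = (N : ℂ)⁻¹ ^ (N + j) := by
    rw [zpow_neg, ← Nat.cast_add, zpow_natCast, inv_pow]
  rw [h1, h2, h3, mul_inv, mul_pow]
  push_cast
  have hpi : (Real.pi : ℂ) * Complex.I ≠ 0 :=
    mul_ne_zero (by exact_mod_cast Real.pi_ne_zero) Complex.I_ne_zero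
  rw [mul_assoc 2 (Real.pi : ℂ)]
  field_simp

theorem vandR_eq_det {n : ℕ} (z : Fin n → ℝ) : vandR z = (Matrix.vandermonde z).det :=
  (Matrix.det_vandermonde z).symm

theorem vandC_eq_det {n : ℕ} (z : Fin n → ℂ) : vandC z = (Matrix.vandermonde z).det :=
  (Matrix.det_vandermonde z).symm

theorem prod_Icc_factorial (n : ℕ) :
    ∏ l ∈ Icc 1 n, (l.factorial : ℂ) = n.factorial * ∏ l : Fin n, ((l : ℕ).factorial : ℂ) := by
  induction n with
  | zero => simp
  | succ n ih =>
    rw [Finset.prod_Icc_succ_top (by omega), ih, Fin.prod_univ_castSucc]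
    simp only [Fin.val_castSucc, Fin.val_last]
    ring

theorem setIntegral_eq_contourFactor {m : ℕ} (α : ℝ) (N : ℕ) (q : Fin m → ℕ)
    (hq : ∀ i, 1 ≤ q i) (μ : Fin m → ℝ) :
    (∫ θ in Set.univ.pi
            (fun _ : (Σ i : Fin m, Fin (2 * q i)) => Set.Ioc (0 : ℝ) (2 * Real.pi)),
          (∏ s : Σ i : Fin m, Fin (2 * q i),
              (Complex.I * Complex.exp (Complex.I * (θ s : ℂ))) *
                (Complex.exp (-2 * N * (μ s.1 : ℂ) * Complex.exp (Complex.I * (θ s : ℂ))) *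
                  (Complex.exp (Complex.I * (θ s : ℂ)) + 2) ^ N *
                  Complex.exp (Complex.I * (θ s : ℂ)) ^ (-(N : ℤ)) *
                  (Complex.I * (Complex.exp (Complex.I * (θ s : ℂ)) + 2) ^ (α : ℂ) *
                    Complex.exp (Complex.I * (θ s : ℂ)) ^ (-(2 * (q s.1 : ℤ)))))) *
            (∏ i : Fin m,
              vandC (fun l : Fin (2 * q i) =>
                Complex.exp (Complex.I * (θ ⟨i, l⟩ : ℂ))) ^ 2) *
            ∏ j : Fin m, ∏ k ∈ Finset.Ioi j, ∏ lk : Fin (2 * q k), ∏ lj : Fin (2 * q j),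
              ((Complex.exp (Complex.I * (θ ⟨k, lk⟩ : ℂ)))⁻¹ -
                (Complex.exp (Complex.I * (θ ⟨j, lj⟩ : ℂ)))⁻¹)) =
      (∏ i, (-1) ^ q i) *
      ∫ θ, (∏ s : Σ i, Fin (2 * q i), (contourFactor α N (μ s.1) (θ s) *
          (Complex.exp (Complex.I * θ s))⁻¹ ^ (2 * q s.1 - 1))) *
        (∏ i, (Matrix.vandermonde
          fun l : Fin (2 * q i) => Complex.exp (Complex.I * θ ⟨i, l⟩)).det ^ 2) *
        (∏ j : Fin m, ∏ k ∈ Ioi j, ∏ lk : Fin (2 * q k), ∏ lj : Fin (2 * q j),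
          ((Complex.exp (Complex.I * θ ⟨k, lk⟩))⁻¹ - (Complex.exp (Complex.I * θ ⟨j, lj⟩))⁻¹))
        ∂(Measure.pi fun _ => volume.restrict (Set.Ioc (0 : ℝ) (2 * Real.pi))) := by
  rw [volume_pi, Measure.restrict_pi_pi, ← integral_const_mul]
  refine integral_congr_ae (Filter.Eventually.of_forall fun θ => ?_)
  have hI : (∏ i, (-1 : ℂ) ^ q i) = ∏ _s : Σ i : Fin m, Fin (2 * q i), Complex.I := by
    rw [Fintype.prod_sigma]
    simp [pow_mul]
  simp only [vandC_eq_det]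
  rw [hI, ← mul_assoc, ← mul_assoc, ← Finset.prod_mul_distrib]
  congr 2
  refine prod_congr rfl fun s _ => ?_
  have hz : Complex.exp (Complex.I * θ s) ≠ 0 := Complex.exp_ne_zero _
  unfold contourFactor
  generalize Complex.exp (Complex.I * θ s) = z at hz ⊢
  have h1 : z ^ (-(2 * (q s.1 : ℤ))) = z⁻¹ ^ (2 * q s.1 - 1) * z⁻¹ := by
    rw [← pow_succ, Nat.sub_add_cancel (by have := hq s.1; omega), inv_pow, zpow_neg]
    norm_cast
  have h2 : z ^ (-(N : ℤ)) = (z ^ N)⁻¹ := by rw [zpow_neg, zpow_natCast]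
  have h3 : -2 * (N : ℂ) * μ s.1 * z = -(2 * N) * μ s.1 * z := by ring
  rw [h1, h2, h3, pow_succ, mul_inv]
  ring

theorem prod_fin_two_mul_sum {M : Type*} [CommMonoid M] {m : ℕ} (q : Fin m → ℕ) (f : ℕ → M) :
    ∏ j : Fin (2 * ∑ i, q i), f j =
      ∏ t : Σ i, Fin (2 * q i), f (finSigmaFinEquiv t : ℕ) := by
  rw [Equiv.prod_comp finSigmaFinEquiv (fun j => f (j : ℕ)), Fin.prod_univ_eq_prod_range,
    Fin.prod_univ_eq_prod_range, Finset.mul_sum]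

theorem setIntegral_laguerre_mul_confluent {N : ℕ} (hN : 1 ≤ N) {m : ℕ} (q : Fin m → ℕ) {α : ℝ}
    (hα : -1 < α) (μ : Fin m → ℝ) :
    (∫ z in Set.univ.pi (fun _ : Fin N => Set.Ioi (0 : ℝ)),
          vandR z ^ 2 * (∏ l, (z l) ^ α * Real.exp (-4 * N * z l)) *
            ∏ l, ∏ i, |μ i - z l| ^ (2 * q i)) *
      ((∏ i, ∏ l : Fin (2 * q i), ((l : ℕ).factorial : ℝ)) *
        ∏ j : Fin m, ∏ k ∈ Ioi j, (μ k - μ j) ^ (2 * q j * (2 * q k))) =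
      (∫ z in Set.univ.pi (fun _ : Fin N => Set.Ioi (0 : ℝ)),
                vandR z ^ 2 * ∏ l, (z l) ^ α * Real.exp (-4 * N * z l)) *
      (Matrix.of fun s t : Σ i, Fin (2 * q i) => (Polynomial.derivative^[s.2]
        (laguerreMonic α (4 * N) (N + finSigmaFinEquiv t))).eval (μ s.1)).det := by
  have hc : (0 : ℝ) < 4 * N := by positivity
  have h := christoffel_confluent (N := N) (fun i => 2 * q i) μ
    (volume.restrict (Set.Ioi 0)) (fun x => x ^ α * Real.exp (-(4 * N) * x))
    (laguerreMonic α (4 * N)) (fun _ => laguerreMonic_monic ..)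
    (fun _ => laguerreMonic_natDegree ..) (fun k => laguerre_moment_integrable hα hc k)
    (fun k a h => laguerreMonic_orthogonal hα hc h)
  rw [volume_pi, Measure.restrict_pi_pi]
  convert h using 2
  · refine integral_congr_ae (Filter.Eventually.of_forall fun z => ?_)
    have h1 : ∏ l, ∏ i, |μ i - z l| ^ (2 * q i) = ∏ i, (∏ l, (μ i - z l)) ^ (2 * q i) := by
      rw [Finset.prod_comm]
      simp only [← Finset.prod_pow, pow_mul, sq_abs]
    simp only [h1, vandR_eq_det, neg_mul]
    ring
  · refine integral_congr_ae (Filter.Eventually.of_forall fun z => ?_)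
    simp only [vandR_eq_det, neg_mul]
    ring

/-- duality formula, Laguerre case.  For the Laguerre weight
`ω_N(x) = x^α e^{-4Nx}` on `(0,∞)`,
`H_{N,N,m,q}(μ)/H_{N+|q|,N} = h_{N,m,q} ∏_i (∏_{l=1}^{2q_i} l!)⁻¹
  ∏_{j<k}(μ_k-μ_j)^{-4q_jq_k} · I_{N,m,q}(μ)`,
where `I` is the `2|q|`-fold contour integral over the positively oriented unit circle
(parametrized by `z_l = e^{iθ_l}`, `dz_l = i e^{iθ_l} dθ_l`, `θ_l ∈ (0, 2π]`; the
variables are grouped in blocks via the sigma type `Σ i, Fin (2 q i)`). -/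
theorem duality_formula_laguerre
    (N : ℕ) (hN : 1 ≤ N) (m : ℕ) (hm : 1 ≤ m)
    (q : Fin m → ℕ) (hq : ∀ i, 1 ≤ q i)
    (α : ℝ) (hα : -1 < α)
    (μ : Fin m → ℝ) (hμ : Function.Injective μ) :
    ((∫ z in Set.univ.pi (fun _ : Fin N => Set.Ioi (0 : ℝ)),
          vandR z ^ 2 * (∏ l, (z l) ^ α * Real.exp (-4 * N * z l)) *
            ∏ l, ∏ i, |μ i - z l| ^ (2 * q i)) /
        (∫ z in Set.univ.pi (fun _ : Fin (N + ∑ i, q i) => Set.Ioi (0 : ℝ)),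
          vandR z ^ 2 * ∏ l, (z l) ^ α * Real.exp (-4 * N * z l)) : ℝ)
    = ((∏ j : Fin (2 * ∑ i, q i),
            ((-1 : ℂ) ^ (N + (j : ℕ)) * ((N + (j : ℕ)).factorial : ℂ) *
              (N : ℂ) ^ (-((N : ℤ) + (j : ℕ))) *
              (((2 : ℝ) ^ (-(2 * (N : ℝ) + ((j : ℕ) + 1) + α)) : ℝ) : ℂ) /
              ((Real.pi : ℂ) * Complex.I))) *
          (∏ i : Fin m, ∏ l : Fin (2 * q i), (-2 * (N : ℂ)) ^ (l : ℕ)) *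
          (((∫ z in Set.univ.pi (fun _ : Fin N => Set.Ioi (0 : ℝ)),
                vandR z ^ 2 * ∏ l, (z l) ^ α * Real.exp (-4 * N * z l)) /
              (∫ z in Set.univ.pi (fun _ : Fin (N + ∑ i, q i) => Set.Ioi (0 : ℝ)),
                vandR z ^ 2 * ∏ l, (z l) ^ α * Real.exp (-4 * N * z l)) : ℝ) : ℂ)) *
        (∏ i : Fin m, (∏ l ∈ Finset.Icc 1 (2 * q i), (l.factorial : ℂ))⁻¹) *
        (∏ j : Fin m, ∏ k ∈ Finset.Ioi j,
            ((μ k - μ j : ℝ) : ℂ) ^ (-(4 * (q j : ℤ) * (q k : ℤ)))) *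
        ∫ θ in Set.univ.pi
            (fun _ : (Σ i : Fin m, Fin (2 * q i)) => Set.Ioc (0 : ℝ) (2 * Real.pi)),
          (∏ s : Σ i : Fin m, Fin (2 * q i),
              (Complex.I * Complex.exp (Complex.I * (θ s : ℂ))) *
                (Complex.exp (-2 * N * (μ s.1 : ℂ) * Complex.exp (Complex.I * (θ s : ℂ))) *
                  (Complex.exp (Complex.I * (θ s : ℂ)) + 2) ^ N *
                  Complex.exp (Complex.I * (θ s : ℂ)) ^ (-(N : ℤ)) *
                  (Complex.I * (Complex.exp (Complex.I * (θ s : ℂ)) + 2) ^ (α : ℂ) *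
                    Complex.exp (Complex.I * (θ s : ℂ)) ^ (-(2 * (q s.1 : ℤ)))))) *
            (∏ i : Fin m,
              vandC (fun l : Fin (2 * q i) =>
                Complex.exp (Complex.I * (θ ⟨i, l⟩ : ℂ))) ^ 2) *
            ∏ j : Fin m, ∏ k ∈ Finset.Ioi j, ∏ lk : Fin (2 * q k), ∏ lj : Fin (2 * q j),
              ((Complex.exp (Complex.I * (θ ⟨k, lk⟩ : ℂ)))⁻¹ -
                (Complex.exp (Complex.I * (θ ⟨j, lj⟩ : ℂ)))⁻¹) := by
  have hreal := setIntegral_laguerre_mul_confluent hN q hα μ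
  have hcontour := integral_det_contour α N q μ
  set M : Matrix (Σ i, Fin (2 * q i)) (Σ i, Fin (2 * q i)) ℂ :=
    Matrix.of fun s t : Σ i, Fin (2 * q i) => ∫ θ in Set.Ioc (0 : ℝ) (2 * Real.pi),
      contourFactor α N (μ s.1) θ * (-(2 * N) * Complex.exp (Complex.I * θ)) ^ (s.2 : ℕ) *
      (1 + 2 * (Complex.exp (Complex.I * θ))⁻¹) ^ (finSigmaFinEquiv t : ℕ)
  rw [setIntegral_eq_contourFactor α N q hq μ]
  generalize (∫ z in Set.univ.pi (fun _ : Fin N => Set.Ioi (0 : ℝ)),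
    vandR z ^ 2 * (∏ l, (z l) ^ α * Real.exp (-4 * N * z l)) *
      ∏ l, ∏ i, |μ i - z l| ^ (2 * q i)) = A at hreal ⊢
  generalize (∫ z in Set.univ.pi (fun _ : Fin N => Set.Ioi (0 : ℝ)),
    vandR z ^ 2 * ∏ l, (z l) ^ α * Real.exp (-4 * N * z l)) = D at hreal ⊢
  generalize (∫ z in Set.univ.pi (fun _ : Fin (N + ∑ i, q i) => Set.Ioi (0 : ℝ)),
    vandR z ^ 2 * ∏ l, (z l) ^ α * Real.exp (-4 * N * z l)) = B
  generalize (∫ θ, _ ∂(Measure.pi fun _ : Σ i, Fin (2 * q i) =>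
    volume.restrict (Set.Ioc (0 : ℝ) (2 * Real.pi))) : ℂ) = J at hcontour ⊢
  have hreal := congrArg (Complex.ofRealHom : ℝ → ℂ) hreal
  rw [map_mul, map_mul Complex.ofRealHom D, RingHom.map_det] at hreal
  have hentry : Complex.ofRealHom.mapMatrix (Matrix.of fun s t : Σ i, Fin (2 * q i) =>
      (Polynomial.derivative^[s.2]
        (laguerreMonic α (4 * N) (N + finSigmaFinEquiv t))).eval (μ s.1)) =
      Matrix.of fun s t => ((-1) ^ (N + (finSigmaFinEquiv t : ℕ)) *
        (N + (finSigmaFinEquiv t : ℕ)).factorial *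
        (4 * N : ℂ)⁻¹ ^ (N + (finSigmaFinEquiv t : ℕ)) * (2 : ℂ) ^ (-(α : ℂ)) /
        (2 * Real.pi * Complex.I)) *
        M s t := by
    ext s t
    exact laguerreMonic_contour_affine α (μ s.1) hN _ _
  rw [hentry, Matrix.det_mul_row] at hreal
  generalize M.det = E at hcontour hreal
  simp only [contour_constant]
  rw [prod_fin_two_mul_sum q fun j => (-1 : ℂ) ^ (N + j) * (N + j).factorial *
    (4 * N : ℂ)⁻¹ ^ (N + j) * (2 : ℂ) ^ (-(α : ℂ)) / (2 * Real.pi * Complex.I) * 2 ^ j,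
    Finset.prod_mul_distrib]
  generalize (∏ t : Σ i, Fin (2 * q i), ((-1 : ℂ) ^ (N + (finSigmaFinEquiv t : ℕ)) *
        (N + (finSigmaFinEquiv t : ℕ)).factorial *
        (4 * N : ℂ)⁻¹ ^ (N + (finSigmaFinEquiv t : ℕ)) * (2 : ℂ) ^ (-(α : ℂ)) /
        (2 * Real.pi * Complex.I))) = K at hreal ⊢
  have hV : ∏ j : Fin m, ∏ k ∈ Ioi j, ((μ k - μ j : ℝ) : ℂ) ^ (-(4 * (q j : ℤ) * (q k : ℤ))) =
      (((∏ j : Fin m, ∏ k ∈ Ioi j, (μ k - μ j) ^ (2 * q j * (2 * q k)) : ℝ)) : ℂ)⁻¹ := by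
    push_cast
    simp only [← Finset.prod_inv_distrib]
    refine prod_congr rfl fun j _ => prod_congr rfl fun k _ => ?_
    rw [zpow_neg, ← zpow_natCast]
    push_cast
    ring_nf
  have hV0 : (((∏ j : Fin m, ∏ k ∈ Ioi j, (μ k - μ j) ^ (2 * q j * (2 * q k)) : ℝ)) : ℂ) ≠ 0 := by
    rw [Complex.ofReal_ne_zero]
    refine Finset.prod_ne_zero_iff.2 fun j _ => Finset.prod_ne_zero_iff.2 fun k hk => ?_
    exact pow_ne_zero _ (sub_ne_zero.2 (hμ.ne (Finset.mem_Ioi.1 hk).ne'))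
  have hF : ∏ i : Fin m, (∏ l ∈ Finset.Icc 1 (2 * q i), (l.factorial : ℂ))⁻¹ =
      ((∏ i, ((2 * q i).factorial : ℂ)) *
        ((∏ i, ∏ l : Fin (2 * q i), ((l : ℕ).factorial : ℝ) : ℝ) : ℂ))⁻¹ := by
    simp only [prod_Icc_factorial, Finset.prod_inv_distrib, Finset.prod_mul_distrib]
    push_cast
    rfl
  have hF1 : (∏ i, ((2 * q i).factorial : ℂ)) ≠ 0 :=
    Finset.prod_ne_zero_iff.2 fun i _ => by exact_mod_cast (2 * q i).factorial_ne_zero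
  have hF2 : ((∏ i, ∏ l : Fin (2 * q i), ((l : ℕ).factorial : ℝ) : ℝ) : ℂ) ≠ 0 := by
    rw [Complex.ofReal_ne_zero]
    exact Finset.prod_ne_zero_iff.2 fun i _ => Finset.prod_ne_zero_iff.2 fun l _ => by
      exact_mod_cast (l : ℕ).factorial_ne_zero
  rw [hV, hF]
  simp only [Complex.ofRealHom_eq_coe, Complex.ofReal_mul] at hreal
  generalize ((∏ j : Fin m, ∏ k ∈ Ioi j, (μ k - μ j) ^ (2 * q j * (2 * q k)) : ℝ) : ℂ) = V
    at hreal hV0 ⊢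
  generalize ((∏ i, ∏ l : Fin (2 * q i), ((l : ℕ).factorial : ℝ) : ℝ) : ℂ) = F₂ at hreal hF2 ⊢
  generalize (∏ i, ((2 * q i).factorial : ℂ)) = F₁ at hcontour hF1 ⊢
  generalize (∏ i, ∏ l : Fin (2 * q i), (-2 * (N : ℂ)) ^ (l : ℕ)) = Q at hcontour ⊢
  rw [Complex.ofReal_div, Complex.ofReal_div]
  rcases eq_or_ne (B : ℂ) 0 with hB | hB
  · simp [hB]
  field_simp
  linear_combination F₁ * hreal + D * K * hcontour
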